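/- arXiv:2001.00158 — 2 statements merged into one kernel-verified Lean document; each statement's English description precedes it below -/
import Mathlib

section
/- Let q = 2^m with m ≥ 4. The narrow-sense BCH code C of length q+1 over GF(q) with designed distance 4 (generator polynomial lcm of the minimal polynomials over GF(q) of β, β^2, β^3, where β is a primitive (q+1)-st root of unity in GF(q^2)) has dimension q−5, and its minimum distance d satisfies d = 6 if m is odd and d = 5 if m is even. -/
lemma pow_four_eq_of_moments {L : Type*} [Field L] {d x : Fin 4 → L}
    (hx : Function.Injective x) (hx0 : x 0 ≠ 0) (hd : d 0 ≠ 0)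
    (h : ∀ k : ℕ, k ≤ 6 → k ≠ 3 → ∑ i, d i * x i ^ k = 0) :
    ∃ c : L, ∀ i, x i ^ 4 = c := by
  have h0 := h 0 (by norm_num) (by norm_num)
  have h1 := h 1 (by norm_num) (by norm_num)
  have h2 := h 2 (by norm_num) (by norm_num)
  have h4 := h 4 (by norm_num) (by norm_num)
  have h5 := h 5 (by norm_num) (by norm_num)
  have h6 := h 6 (by norm_num) (by norm_num)
  simp only [Fin.sum_univ_four] at h0 h1 h2 h4 h5 h6
  have hne : d 0 * ((x 0 - x 1) * (x 0 - x 2) * (x 0 - x 3)) ≠ 0 := by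
    simp [hd, sub_eq_zero, hx.eq_iff]
  refine ⟨-(x 0 * x 1 * x 2 * x 3), Fin.forall_fin_succ.2 ?_⟩
  simp only [Fin.forall_fin_succ, Fin.succ_zero_eq_one, Fin.succ_one_eq_two,
    IsEmpty.forall_iff, and_true,
    show Fin.succ (2 : Fin 3) = 3 from rfl]
  generalize d 0 = d₀, d 1 = d₁, d 2 = d₂, d 3 = d₃, x 0 = x₀, x 1 = x₁, x 2 = x₂, x 3 = x₃ at *
  obtain ⟨a, ha⟩ : ∃ a, a = x₁ + x₂ + x₃ := ⟨_, rfl⟩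
  obtain ⟨b, hb⟩ : ∃ b, b = x₁ * x₂ + x₁ * x₃ + x₂ * x₃ := ⟨_, rfl⟩
  obtain ⟨c, hc⟩ : ∃ c, c = x₁ * x₂ * x₃ := ⟨_, rfl⟩
  have e1 : x₀ + a = 0 := by
    refine mul_left_cancel₀ hne ?_
    subst a
    linear_combination h4 + (-(x₁ + x₂ + x₃) ^ 2 + (x₁ * x₂ + x₁ * x₃ + x₂ * x₃)) * h2 +
      ((x₁ + x₂ + x₃) * (x₁ * x₂ + x₁ * x₃ + x₂ * x₃) - x₁ * x₂ * x₃) * h1 -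
      (x₁ + x₂ + x₃) * (x₁ * x₂ * x₃) * h0
  have e2 : x₀ * a + b = 0 := by
    refine mul_left_cancel₀ (mul_ne_zero hne hx0) ?_
    have := congr(a * $h5 + (b - a ^ 2) * $h4 + (b ^ 2 - c * a) * $h2 - b * c * $h1)
    subst a b c
    linear_combination this
  have e3 : x₀ * b + c = 0 := by
    refine mul_left_cancel₀ (mul_ne_zero hne (pow_ne_zero 2 hx0)) ?_
    have := congr(b * $h6 + (c - a * b) * $h5 + (b ^ 2 - c * a) * $h4 - c ^ 2 * $h2)
    subst a b c
    linear_combination this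
  subst a b c
  refine ⟨?_, ?_, ?_, ?_⟩
  · linear_combination x₀ ^ 3 * e1 - x₀ ^ 2 * e2 + x₀ * e3
  · linear_combination x₁ ^ 3 * e1 - x₁ ^ 2 * e2 + x₁ * e3
  · linear_combination x₂ ^ 3 * e1 - x₂ ^ 2 * e2 + x₂ * e3
  · linear_combination x₃ ^ 3 * e1 - x₃ ^ 2 * e2 + x₃ * e3

lemma exists_pow_four_mul_sub_eq_of_moments {L : Type*} [Field L] {d x : Fin 5 → L}
    (hx : Function.Injective x) (hx0 : x 0 ≠ 0) (hd : d 0 ≠ 0)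
    (h : ∀ k : ℕ, k ≤ 6 → k ≠ 3 → ∑ i, d i * x i ^ k = 0) :
    ∃ a b c : L, ∀ i, x i ^ 4 * (x i - a) = b * x i + c := by
  have h0 := h 0 (by norm_num) (by norm_num)
  have h1 := h 1 (by norm_num) (by norm_num)
  have h2 := h 2 (by norm_num) (by norm_num)
  have h4 := h 4 (by norm_num) (by norm_num)
  have h5 := h 5 (by norm_num) (by norm_num)
  have h6 := h 6 (by norm_num) (by norm_num)
  simp only [Fin.sum_univ_five] at h0 h1 h2 h4 h5 h6
  have hne : d 0 * ((x 0 - x 1) * (x 0 - x 2) * (x 0 - x 3) * (x 0 - x 4)) ≠ 0 := by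
    simp [hd, sub_eq_zero, hx.eq_iff]
  refine ⟨x 0 + x 1 + x 2 + x 3 + x 4,
    -(x 0 * (x 1 * x 2 * x 3 + x 1 * x 2 * x 4 + x 1 * x 3 * x 4 + x 2 * x 3 * x 4) +
      x 1 * x 2 * x 3 * x 4), x 0 * x 1 * x 2 * x 3 * x 4, Fin.forall_fin_succ.2 ?_⟩
  simp only [Fin.forall_fin_succ, Fin.succ_zero_eq_one, Fin.succ_one_eq_two,
    IsEmpty.forall_iff, and_true,
    show Fin.succ (2 : Fin 4) = 3 from rfl, show Fin.succ (Fin.succ (2 : Fin 3)) = 4 from rfl]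
  generalize d 0 = d₀, d 1 = d₁, d 2 = d₂, d 3 = d₃, d 4 = d₄,
    x 0 = x₀, x 1 = x₁, x 2 = x₂, x 3 = x₃, x 4 = x₄ at *
  obtain ⟨a, ha⟩ : ∃ a, a = x₁ + x₂ + x₃ + x₄ := ⟨_, rfl⟩
  obtain ⟨b, hb⟩ : ∃ b, b = x₁ * x₂ + x₁ * x₃ + x₁ * x₄ + x₂ * x₃ + x₂ * x₄ + x₃ * x₄ := ⟨_, rfl⟩
  obtain ⟨c, hc⟩ : ∃ c, c = x₁ * x₂ * x₃ + x₁ * x₂ * x₄ + x₁ * x₃ * x₄ + x₂ * x₃ * x₄ := ⟨_, rfl⟩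
  obtain ⟨e, he⟩ : ∃ e, e = x₁ * x₂ * x₃ * x₄ := ⟨_, rfl⟩
  have e2 : x₀ * a + b = 0 := by
    refine mul_left_cancel₀ hne ?_
    have := congr(a * $h5 + (b - a ^ 2) * $h4 + (b ^ 2 - c * a) * $h2 +
      (a * e - b * c) * $h1 + b * e * $h0)
    subst a b c e
    linear_combination this
  have e3 : x₀ * b + c = 0 := by
    refine mul_left_cancel₀ (mul_ne_zero hne hx0) ?_
    have := congr(b * $h6 + (c - a * b) * $h5 + (b ^ 2 - c * a) * $h4 +
      (b * e - c ^ 2) * $h2 + c * e * $h1)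
    subst a b c e
    linear_combination this
  subst a b c e
  refine ⟨?_, ?_, ?_, ?_, ?_⟩
  · linear_combination - x₀ ^ 3 * e2 + x₀ ^ 2 * e3
  · linear_combination - x₁ ^ 3 * e2 + x₁ ^ 2 * e3
  · linear_combination - x₂ ^ 3 * e2 + x₂ ^ 2 * e3
  · linear_combination - x₃ ^ 3 * e2 + x₃ ^ 2 * e3
  · linear_combination - x₄ ^ 3 * e2 + x₄ ^ 2 * e3

/-- If `t ↦ t ^ 4` agrees with a fractional linear map at four points, then in characteristic two
their cross-ratio is a cube root of unity. -/
lemma crossRatio_pow_three {L : Type*} [Field L] [CharP L 2] {a b c x y z w : L}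
    (hxy : x ≠ y) (hxz : x ≠ z) (hxw : x ≠ w) (hyz : y ≠ z) (hyw : y ≠ w) (hzw : z ≠ w)
    (hx : x ^ 4 * (x - a) = b * x + c) (hy : y ^ 4 * (y - a) = b * y + c)
    (hz : z ^ 4 * (z - a) = b * z + c) (hw : w ^ 4 * (w - a) = b * w + c) :
    ((x - y) * (z - w)) ^ 3 = ((x - w) * (z - y)) ^ 3 := by
  have key : ∀ s t : L, s ≠ t → s ^ 4 * (s - a) = b * s + c → t ^ 4 * (t - a) = b * t + c →
      (s - a) * (t - a) * (s - t) ^ 3 = -(a * b + c) := by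
    intro s t hst hs ht
    have h4 : (s - t) ^ 4 = s ^ 4 - t ^ 4 := sub_pow_char_pow (p := 2) (n := 2) s t
    refine mul_right_cancel₀ (sub_ne_zero.2 hst) ?_
    linear_combination (s - a) * (t - a) * h4 + (t - a) * hs - (s - a) * ht
  have kxy := key x y hxy hx hy
  have kzw := key z w hzw hz hw
  have kxw := key x w hxw hx hw
  have kzy := key z y hyz.symm hz hy
  have kxz := key x z hxz hx hz
  have kyw := key y w hyw hy hw
  have hD : a * b + c ≠ 0 := by
    intro h0
    rw [h0, neg_zero] at kxy kzw kxw kzy kxz kyw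
    simp only [mul_eq_zero, sub_eq_zero, pow_eq_zero_iff, ne_eq, OfNat.ofNat_ne_zero,
      not_false_eq_true] at kxy kzw kxw kzy kxz kyw
    grind
  have hp : (x - a) * (y - a) * (z - a) * (w - a) ≠ 0 := by
    intro h0
    apply hD
    have : (a * b + c) ^ 2 = 0 := by
      linear_combination (a * b + c) * kxy - (x - a) * (y - a) * (x - y) ^ 3 * kzw
        + (x - y) ^ 3 * (z - w) ^ 3 * h0
    exact pow_eq_zero_iff (two_ne_zero) |>.1 this
  refine mul_left_cancel₀ hp ?_
  have := congr($kxy * $kzw - $kxw * $kzy)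
  linear_combination this

lemma mem_range_algebraMap_of_pow_card_eq {K L : Type*} [Field K] [Fintype K] [Field L]
    [Algebra K L] {x : L} (hx : x ^ Fintype.card K = x) : ∃ y : K, algebraMap K L y = x := by
  classical
  by_contra! hne
  have hp := FiniteField.X_pow_card_sub_X_ne_zero L (Fintype.one_lt_card (α := K))
  have hsub : (insert x (Finset.univ.map ⟨algebraMap K L, (algebraMap K L).injective⟩)).val ⊆
      (Polynomial.X ^ Fintype.card K - Polynomial.X : Polynomial L).roots := by
    intro y hy
    rw [Polynomial.mem_roots hp, Polynomial.IsRoot.def]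
    simp only [Finset.mem_val, Finset.mem_insert, Finset.mem_map, Finset.mem_univ, true_and,
      Function.Embedding.coeFn_mk] at hy
    rcases hy with rfl | ⟨z, rfl⟩
    · simp [hx]
    · simp [← map_pow, FiniteField.pow_card]
  have hcard := Polynomial.card_le_degree_of_subset_roots hsub
  rw [FiniteField.X_pow_card_sub_X_natDegree_eq L (Fintype.one_lt_card (α := K)),
    Finset.card_insert_of_notMem (by simpa using hne), Finset.card_map, Finset.card_univ] at hcard
  omega

/-- If `x ↦ x ^ 2 ^ m` inverts four distinct elements, it fixes their cross-ratio, which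
is therefore not a cube root of unity when `m` is odd. -/
lemma crossRatio_pow_three_ne {L : Type*} [Field L] {m : ℕ} [CharP L 2] (hm : Odd m)
    {x y z w : L} (hxz : x ≠ z) (hxw : x ≠ w) (hyz : y ≠ z) (hyw : y ≠ w)
    (hx : x ^ 2 ^ m * x = 1) (hy : y ^ 2 ^ m * y = 1) (hz : z ^ 2 ^ m * z = 1)
    (hw : w ^ 2 ^ m * w = 1) :
    ((x - y) * (z - w)) ^ 3 ≠ ((x - w) * (z - y)) ^ 3 := by
  intro h
  have hB : (x - w) * (z - y) ≠ 0 := mul_ne_zero (sub_ne_zero.2 hxw) (sub_ne_zero.2 hyz.symm)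
  obtain ⟨l, hl⟩ : ∃ l, (x - y) * (z - w) = l * ((x - w) * (z - y)) :=
    ⟨(x - y) * (z - w) / ((x - w) * (z - y)), by field_simp⟩
  have hl3 : l ^ 3 = 1 := by
    refine mul_right_cancel₀ (pow_ne_zero 3 hB) ?_
    rw [← mul_pow, ← hl, h, one_mul]
  have conj : ∀ s t : L, s ^ 2 ^ m * s = 1 → t ^ 2 ^ m * t = 1 →
      (s - t) ^ 2 ^ m * (s * t) = -(s - t) := by
    intro s t hs ht
    rw [sub_pow_char_pow]
    linear_combination t * hs - s * ht
  have hlq : l ^ 2 ^ m = l := by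
    have hA := congr($(conj x y hx hy) * $(conj z w hz hw))
    have hB' := congr($(conj x w hx hw) * $(conj z y hz hy))
    have hl' := congr($hl ^ 2 ^ m)
    simp only [mul_pow] at hl'
    refine mul_right_cancel₀ hB ?_
    linear_combination hA - l ^ 2 ^ m * hB' - (x * y * z * w) * hl' + hl
  obtain ⟨k, hk⟩ : ∃ k, 2 ^ m = 3 * k + 2 := by
    have : 2 ^ m % 3 = 2 := by
      obtain ⟨r, rfl⟩ := hm
      rw [pow_succ, pow_mul, Nat.mul_mod, Nat.pow_mod]; norm_num
    exact ⟨2 ^ m / 3, by omega⟩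
  rw [hk, pow_add, pow_mul, hl3, one_pow, one_mul] at hlq
  have hl1 : l = 1 := by linear_combination hl3 - (l + 1) * hlq
  apply mul_ne_zero (sub_ne_zero.2 hxz) (sub_ne_zero.2 hyw)
  rw [hl1] at hl
  linear_combination hl

lemma moment_eq_zero_of_bch {K L : Type*} [Field K] [Fintype K] [Field L] [Algebra K L]
    [CharP L 2] {m n : ℕ} (hK : Fintype.card K = 2 ^ m) {β : L} (hβ : β ^ (2 ^ m + 1) = 1)
    {c : Fin n → K}
    (hc : ∀ j ∈ ({1, 2, 3} : Set ℕ), ∑ i, algebraMap K L (c i) * β ^ ((i : ℕ) * j) = 0)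
    {k : ℕ} (hk : k ≤ 6) (hk3 : k ≠ 3) :
    ∑ i, algebraMap K L (c i) * ((β ^ (i : ℕ))⁻¹) ^ 3 * (β ^ (i : ℕ)) ^ k = 0 := by
  have hβ0 : β ≠ 0 := by rintro rfl; simp at hβ
  have hβq : β ^ 2 ^ m = β⁻¹ := eq_inv_of_mul_eq_one_left (by rw [← pow_succ, hβ])
  rcases lt_or_gt_of_ne hk3 with hlt | hgt
  · have hj : 3 - k ∈ ({1, 2, 3} : Set ℕ) := by
      simp only [Set.mem_insert_iff, Set.mem_singleton_iff]; omega
    have h := congr($(hc _ hj) ^ 2 ^ m)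
    rw [sum_pow_char_pow, zero_pow (by positivity)] at h
    rw [← h]
    refine Finset.sum_congr rfl fun i _ => ?_
    have hi : (β ^ ((i : ℕ) * (3 - k))) ^ 2 ^ m = ((β ^ (i : ℕ))⁻¹) ^ 3 * (β ^ (i : ℕ)) ^ k := by
      rw [pow_mul, ← pow_mul, mul_comm (3 - k), pow_mul, pow_right_comm β, hβq,
        pow_sub₀ _ (pow_ne_zero _ (inv_ne_zero hβ0)) hlt.le]
      simp only [inv_pow, inv_inv]
    rw [mul_pow, ← map_pow, ← hK, FiniteField.pow_card, hK, hi, mul_assoc]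
  · obtain ⟨l, rfl⟩ := Nat.exists_eq_add_of_lt hgt
    have hj : l + 1 ∈ ({1, 2, 3} : Set ℕ) := by
      simp only [Set.mem_insert_iff, Set.mem_singleton_iff]; omega
    rw [← hc _ hj]
    refine Finset.sum_congr rfl fun i _ => ?_
    rw [mul_assoc, pow_mul, add_assoc, pow_add _ 3, ← mul_assoc (_ ^ 3), ← mul_pow,
      inv_mul_cancel₀ (pow_ne_zero _ hβ0), one_pow, one_mul]

/-- The moments of a word supported on at most `w` positions are those of `w` points. -/
lemma exists_moments_of_card_support_le {K L : Type*} [Field K] [DecidableEq K] [Fintype K]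
    [Field L] [Algebra K L] [CharP L 2] {m w : ℕ} (hK : Fintype.card K = 2 ^ m)
    {β : L} (hβ : orderOf β = 2 ^ m + 1) (hw : w + 1 ≤ 2 ^ m + 1) {c : Fin (2 ^ m + 1) → K}
    (hc : ∀ j ∈ ({1, 2, 3} : Set ℕ), ∑ i, algebraMap K L (c i) * β ^ ((i : ℕ) * j) = 0)
    (hc0 : c ≠ 0) (hcw : (Finset.univ.filter fun i => c i ≠ 0).card ≤ w + 1) :
    ∃ d x : Fin (w + 1) → L, Function.Injective x ∧ (∀ i, x i ^ 2 ^ m * x i = 1) ∧ d 0 ≠ 0 ∧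
      ∀ k : ℕ, k ≤ 6 → k ≠ 3 → ∑ i, d i * x i ^ k = 0 := by
  obtain ⟨T, hST, hT⟩ := Finset.exists_superset_card_eq hcw (by simpa using hw)
  obtain ⟨i₀, hi₀⟩ := Function.ne_iff.1 hc0
  have hf := T.range_orderEmbOfFin hT
  obtain ⟨k₀, hk₀⟩ : i₀ ∈ Set.range (T.orderEmbOfFin hT) := by
    rw [hf]; exact hST (by simpa using hi₀)
  obtain ⟨f, hfdef⟩ : ∃ f : Fin (w + 1) → Fin (2 ^ m + 1),
    f = T.orderEmbOfFin hT ∘ Equiv.swap 0 k₀ := ⟨_, rfl⟩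
  have hfi : Function.Injective f :=
    hfdef ▸ (T.orderEmbOfFin hT).injective.comp (Equiv.injective _)
  have hfr : ∀ i ∉ Set.range f, c i = 0 := by
    intro i hi
    by_contra hne
    rw [hfdef, (Equiv.surjective _).range_comp, hf] at hi
    exact hi (hST (by simpa using hne))
  have hβ1 : β ^ (2 ^ m + 1) = 1 := hβ ▸ pow_orderOf_eq_one β
  have hβ0 : β ≠ 0 := by rintro rfl; simp at hβ1
  refine ⟨fun k => algebraMap K L (c (f k)) * ((β ^ (f k : ℕ))⁻¹) ^ 3, fun k => β ^ (f k : ℕ),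
    fun a b hab => hfi (Fin.ext (pow_injOn_Iio_orderOf ?_ ?_ hab)), fun i => ?_, ?_, ?_⟩
  · simpa [hβ] using (f a).is_le
  · simpa [hβ] using (f b).is_le
  · rw [← pow_succ, pow_right_comm, hβ1, one_pow]
  · simpa [hfdef, hk₀, hβ0] using hi₀
  · intro k hk hk3
    rw [← moment_eq_zero_of_bch hK hβ1 hc hk hk3]
    exact Fintype.sum_of_injective f hfi _ _ (fun i hi => by simp [hfr i hi]) fun _ => rfl

lemma five_le_card_support {K L : Type*} [Field K] [DecidableEq K] [Fintype K]
    [Field L] [Algebra K L] [CharP L 2] {m : ℕ} (hm : 2 ≤ m) (hK : Fintype.card K = 2 ^ m)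
    {β : L} (hβ : orderOf β = 2 ^ m + 1) {c : Fin (2 ^ m + 1) → K}
    (hc : ∀ j ∈ ({1, 2, 3} : Set ℕ), ∑ i, algebraMap K L (c i) * β ^ ((i : ℕ) * j) = 0)
    (hc0 : c ≠ 0) : 5 ≤ (Finset.univ.filter fun i => c i ≠ 0).card := by
  by_contra! hlt
  have hq : 2 ^ 2 ≤ 2 ^ m := Nat.pow_le_pow_right two_pos hm
  obtain ⟨d, x, hx, hx1, hd, h⟩ := exists_moments_of_card_support_le (w := 3) hK hβ
    (by omega) hc hc0 (by omega)
  obtain ⟨a, ha⟩ := pow_four_eq_of_moments hx (right_ne_zero_of_mul_eq_one (hx1 0)) hd h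
  have h4 : (x 0 - x 1) ^ 4 = x 0 ^ 4 - x 1 ^ 4 := sub_pow_char_pow (p := 2) (n := 2) _ _
  rw [ha, ha, sub_self, pow_eq_zero_iff (by norm_num), sub_eq_zero, hx.eq_iff] at h4
  simp at h4

lemma six_le_card_support {K L : Type*} [Field K] [DecidableEq K] [Fintype K]
    [Field L] [Algebra K L] [CharP L 2] {m : ℕ} (hm : 2 ≤ m) (hodd : Odd m)
    (hK : Fintype.card K = 2 ^ m)
    {β : L} (hβ : orderOf β = 2 ^ m + 1) {c : Fin (2 ^ m + 1) → K}
    (hc : ∀ j ∈ ({1, 2, 3} : Set ℕ), ∑ i, algebraMap K L (c i) * β ^ ((i : ℕ) * j) = 0)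
    (hc0 : c ≠ 0) : 6 ≤ (Finset.univ.filter fun i => c i ≠ 0).card := by
  by_contra! hlt
  have hq : 2 ^ 2 ≤ 2 ^ m := Nat.pow_le_pow_right two_pos hm
  obtain ⟨d, x, hx, hx1, hd, h⟩ := exists_moments_of_card_support_le (w := 4) hK hβ
    (by omega) hc hc0 (by omega)
  obtain ⟨a, b, e, ha⟩ :=
    exists_pow_four_mul_sub_eq_of_moments hx (right_ne_zero_of_mul_eq_one (hx1 0)) hd h
  have hne {i j : Fin 5} (hij : i ≠ j) : x i ≠ x j := hx.ne hij
  exact crossRatio_pow_three_ne hodd (hne (by decide)) (hne (by decide)) (hne (by decide))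
    (hne (by decide)) (hx1 0) (hx1 1) (hx1 2) (hx1 3)
    (crossRatio_pow_three (hne (by decide)) (hne (by decide)) (hne (by decide))
      (hne (by decide)) (hne (by decide)) (hne (by decide)) (ha 0) (ha 1) (ha 2) (ha 3))

/-- Weights fixed by `x ↦ x ^ 2 ^ m` on `(2 ^ m + 1)`-st roots of unity define a codeword. -/
lemma exists_bch_word {ι K L : Type*} [Fintype ι] [Field K] [DecidableEq K] [Fintype K]
    [Field L] [Algebra K L] {m : ℕ} (hK : Fintype.card K = 2 ^ m)
    {β : L} (hβ : orderOf β = 2 ^ m + 1) {u a : ι → L} (hu : ∀ k, u k ^ (2 ^ m + 1) = 1)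
    (ha : ∀ k, a k ^ 2 ^ m = a k) {k₀ : ι} (hk₀ : ∀ k ≠ k₀, u k ≠ u k₀) (ha0 : a k₀ ≠ 0)
    (h : ∀ j ∈ ({1, 2, 3} : Set ℕ), ∑ k, a k * u k ^ j = 0) :
    ∃ c : Fin (2 ^ m + 1) → K,
      (∀ j ∈ ({1, 2, 3} : Set ℕ), ∑ i, algebraMap K L (c i) * β ^ ((i : ℕ) * j) = 0) ∧
      c ≠ 0 ∧ (Finset.univ.filter fun i => c i ≠ 0).card ≤ Fintype.card ι := by
  classical
  have hb : ∀ k, ∃ b : K, algebraMap K L b = a k := fun k =>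
    mem_range_algebraMap_of_pow_card_eq (by rw [hK, ha])
  choose b hb using hb
  have hprim : IsPrimitiveRoot β (2 ^ m + 1) := hβ ▸ IsPrimitiveRoot.orderOf β
  have hv : ∀ k, ∃ v : Fin (2 ^ m + 1), β ^ (v : ℕ) = u k := fun k => by
    obtain ⟨i, hi, hik⟩ := hprim.eq_pow_of_pow_eq_one (hu k)
    exact ⟨⟨i, hi⟩, hik⟩
  choose v hv using hv
  refine ⟨fun i => ∑ k, if v k = i then b k else 0, fun j hj => ?_, ?_, ?_⟩
  · rw [← h j hj]
    simp only [map_sum, Finset.sum_mul]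
    rw [Finset.sum_comm]
    refine Finset.sum_congr rfl fun k _ => ?_
    rw [Finset.sum_eq_single (v k) (fun i _ hi => by simp [hi.symm]) (by simp)]
    rw [if_pos rfl, hb, pow_mul, hv]
  · refine Function.ne_iff.2 ⟨v k₀, ?_⟩
    rw [Finset.sum_eq_single k₀ _ (by simp), if_pos rfl]
    · rintro h0
      rw [Pi.zero_apply] at h0
      exact ha0 (by rw [← hb, h0, map_zero])
    · intro k _ hk
      exact if_neg fun hvk => hk₀ k hk (by rw [← hv, ← hv, hvk])
  · refine (Finset.card_le_card (t := Finset.univ.image v) fun i hi => ?_).trans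
      Finset.card_image_le
    obtain ⟨k, -, hk⟩ := Finset.exists_ne_zero_of_sum_ne_zero (Finset.mem_filter.1 hi).2
    simp only [ne_eq, ite_eq_right_iff, Classical.not_imp] at hk
    exact Finset.mem_image.2 ⟨k, Finset.mem_univ _, hk.1⟩

/-- Sums over the affine points of the projective line over the field with four elements. -/
lemma sum_pow_mul_pow_quartic {L : Type*} [Field L] [CharP L 2] {w : L} (hw : w ^ 2 + w + 1 = 0)
    (A p s : L) :
    1 + ((0 + A) ^ 4 * ((0 + p) * (0 + s)) + (1 + A) ^ 4 * ((1 + p) * (1 + s)) +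
      (w + A) ^ 4 * ((w + p) * (w + s)) + (w + 1 + A) ^ 4 * ((w + 1 + p) * (w + 1 + s))) = 0 := by
  have h2 : (2 : L) = 0 := CharTwo.two_eq_zero
  have h4 : ∀ x y : L, (x + y) ^ 4 = x ^ 4 + y ^ 4 := fun x y =>
    add_pow_char_pow (p := 2) (n := 2) x y
  have hw4 : w ^ 4 = w := by linear_combination (w ^ 2 - w) * hw
  rw [h4 (w + 1), h4, h4, h4, h4, hw4]
  grind

lemma exists_bch_word_card_support_le_five {K L : Type*} [Field K] [DecidableEq K] [Fintype K]
    [Field L] [Algebra K L] [CharP L 2] {m : ℕ} (hm : 2 ≤ m) (heven : Even m)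
    (hK : Fintype.card K = 2 ^ m) {β : L} (hβ : orderOf β = 2 ^ m + 1) :
    ∃ c : Fin (2 ^ m + 1) → K,
      (∀ j ∈ ({1, 2, 3} : Set ℕ), ∑ i, algebraMap K L (c i) * β ^ ((i : ℕ) * j) = 0) ∧
      c ≠ 0 ∧ (Finset.univ.filter fun i => c i ≠ 0).card ≤ 5 := by
  have hβ1 : β ^ (2 ^ m + 1) = 1 := hβ ▸ pow_orderOf_eq_one β
  have hβ0 : β ≠ 0 := by rintro rfl; simp at hβ1
  have hβq : β ^ 2 ^ m = β⁻¹ := eq_inv_of_mul_eq_one_left (by rw [← pow_succ, hβ1])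
  have hq : 2 ^ 2 ≤ 2 ^ m := Nat.pow_le_pow_right two_pos hm
  have hββ : β ≠ β⁻¹ := by
    intro h
    have : orderOf β ∣ 2 := orderOf_dvd_of_pow_eq_one (by
      rw [pow_two]; nth_rewrite 2 [h]; exact mul_inv_cancel₀ hβ0)
    have := Nat.le_of_dvd two_pos this
    omega
  obtain ⟨w, hwq, hw⟩ : ∃ w : L, w ^ 2 ^ m = w ∧ w ^ 2 + w + 1 = 0 := by
    have : Fact (Nat.Prime 3) := ⟨Nat.prime_three⟩
    have hdvd : 3 ∣ Fintype.card Kˣ := by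
      rw [Fintype.card_units, hK]
      obtain ⟨r, rfl⟩ := heven
      rw [← two_mul, pow_mul]
      exact Nat.sub_one_dvd_pow_sub_one (2 ^ 2) r
    obtain ⟨v, hv⟩ := exists_prime_orderOf_dvd_card 3 hdvd
    have hv3 : v ^ 3 = 1 := hv ▸ pow_orderOf_eq_one v
    have hv1 : (v : K) - 1 ≠ 0 := by
      rw [sub_ne_zero, ne_eq, Units.val_eq_one]
      rintro rfl
      simp at hv
    refine ⟨algebraMap K L v, by rw [← map_pow, ← hK, FiniteField.pow_card], ?_⟩
    have hv3' : (v : K) ^ 3 = 1 := by rw [← Units.val_pow_eq_pow_val, hv3, Units.val_one]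
    rw [← map_pow, ← map_add, ← map_one (algebraMap K L), ← map_add, map_eq_zero]
    exact mul_left_cancel₀ hv1 (by linear_combination hv3')
  obtain ⟨t, ht⟩ : ∃ t : Fin 4 → L, t = ![0, 1, w, w + 1] := ⟨_, rfl⟩
  have htq : ∀ k, t k ^ 2 ^ m = t k := by
    subst ht
    simp [Fin.forall_fin_succ, add_pow_char_pow, hwq]
  have htβ : ∀ k, (t k + β) ^ 2 ^ m = t k + β⁻¹ := fun k => by
    rw [add_pow_char_pow, htq, hβq]
  have htβ' : ∀ k, (t k + β⁻¹) ^ 2 ^ m = t k + β := fun k => by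
    rw [add_pow_char_pow, htq, inv_pow, hβq, inv_inv]
  have hne : ∀ k, t k + β ≠ 0 := fun k h => hββ <| by
    rw [CharTwo.add_eq_zero] at h
    rw [← hβq, ← h, htq]
  have hne' : ∀ k, t k + β⁻¹ ≠ 0 := fun k => htβ k ▸ pow_ne_zero _ (hne k)
  have hterm : ∀ k (j : ℕ), j < 3 → ((t k + β) * (t k + β⁻¹)) ^ 3 *
      ((t k + β) / (t k + β⁻¹)) ^ (j + 1) =
        (t k + β) ^ 4 * ((t k + β) ^ j * (t k + β⁻¹) ^ (2 - j)) := by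
    intro k j hj
    have := hne' k
    generalize t k + β⁻¹ = v at *
    interval_cases j <;> norm_num <;> field_simp
  refine exists_bch_word (ι := Option (Fin 4)) hK hβ
    (u := fun k => k.elim 1 fun k => (t k + β) / (t k + β⁻¹))
    (a := fun k => k.elim 1 fun k => ((t k + β) * (t k + β⁻¹)) ^ 3) (k₀ := none) ?_ ?_ ?_ ?_ ?_
  · rintro (_ | k)
    · simp
    · simp only [Option.elim_some]
      rw [pow_succ, div_pow, htβ, htβ', div_mul_div_cancel₀ (hne k), div_self (hne' k)]
  · rintro (_ | k)
    · simp
    · simp only [Option.elim_some]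
      rw [pow_right_comm, mul_pow, htβ, htβ', mul_comm]
  · rintro (_ | k) hk
    · exact absurd rfl hk
    · simpa [div_eq_one_iff_eq (hne' k)] using hββ
  · simp
  · intro j hj
    have hsum : ∀ p s : L, 1 + ∑ k, (t k + β) ^ 4 * ((t k + p) * (t k + s)) = 0 := fun p s => by
      rw [Fin.sum_univ_four, ht]
      exact sum_pow_mul_pow_quartic hw β p s
    obtain ⟨i, rfl, hi⟩ : ∃ i, j = i + 1 ∧ i < 3 := ⟨j - 1, by
      simp only [Set.mem_insert_iff, Set.mem_singleton_iff] at hj; omega⟩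
    rw [Fintype.sum_option]
    simp only [Option.elim_some, Option.elim_none, one_pow, mul_one, hterm _ _ hi]
    interval_cases i
    · simpa [pow_two] using hsum β⁻¹ β⁻¹
    · simpa using hsum β β⁻¹
    · simpa [pow_two] using hsum β β

lemma exists_bch_word_card_support_le_six {K L : Type*} [Field K] [DecidableEq K] [Fintype K]
    [Field L] [Fintype L] [Algebra K L] [CharP L 2] {m : ℕ} (hm : 4 ≤ m) (hodd : Odd m)
    (hK : Fintype.card K = 2 ^ m) (hL : Fintype.card L = 2 ^ (2 * m))
    {β : L} (hβ : orderOf β = 2 ^ m + 1) :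
    ∃ c : Fin (2 ^ m + 1) → K,
      (∀ j ∈ ({1, 2, 3} : Set ℕ), ∑ i, algebraMap K L (c i) * β ^ ((i : ℕ) * j) = 0) ∧
      c ≠ 0 ∧ (Finset.univ.filter fun i => c i ≠ 0).card ≤ 6 := by
  have h2 : (2 : L) = 0 := CharTwo.two_eq_zero
  have hβ1 : β ^ (2 ^ m + 1) = 1 := hβ ▸ pow_orderOf_eq_one β
  have hβ0 : β ≠ 0 := by rintro rfl; simp at hβ1
  have hq : 2 ^ 4 ≤ 2 ^ m := Nat.pow_le_pow_right two_pos hm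
  have hβn : ∀ k, 0 < k → k < 10 → β ^ k ≠ 1 := fun k hk hk' =>
    pow_ne_one_of_lt_orderOf hk.ne' (by omega)
  have hconj : ∀ x : L, x ^ (2 ^ m + 1) = 1 → x ^ 2 ^ m * x = 1 := fun x hx => by
    rw [← pow_succ, hx]
  have hinvol : ∀ x : L, (x ^ 2 ^ m) ^ 2 ^ m = x := fun x => by
    rw [← pow_mul, ← pow_add, ← two_mul, ← hL, FiniteField.pow_card]
  obtain ⟨w, hwn, hw⟩ : ∃ w : L, w ^ (2 ^ m + 1) = 1 ∧ w ^ 2 + w + 1 = 0 := by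
    have hdvd : 2 ^ m + 1 = 3 * ((2 ^ m + 1) / 3) := by
      have : 2 ^ m % 3 = 2 := by
        obtain ⟨r, rfl⟩ := hodd
        rw [pow_succ, pow_mul, Nat.mul_mod, Nat.pow_mod]; norm_num
      omega
    refine ⟨β ^ ((2 ^ m + 1) / 3), by rw [pow_right_comm, hβ1, one_pow], ?_⟩
    have h1 : β ^ ((2 ^ m + 1) / 3) ≠ 1 := pow_ne_one_of_lt_orderOf (by omega) (by omega)
    have h3 : (β ^ ((2 ^ m + 1) / 3)) ^ 3 = 1 := by
      rw [← pow_mul, mul_comm, ← hdvd, hβ1]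
    exact mul_left_cancel₀ (sub_ne_zero.2 h1) (by linear_combination h3)
  have hw3 : w ^ 3 = 1 := by linear_combination (w - 1) * hw
  have hwq : w ^ 2 ^ m = w ^ 2 := by
    have := hconj w hwn
    linear_combination w ^ 2 * this - w ^ 2 ^ m * hw3
  have hw2q : (w ^ 2) ^ 2 ^ m = w := by rw [← hwq, hinvol]
  obtain ⟨x, hx⟩ : ∃ x, x = β := ⟨_, rfl⟩
  obtain ⟨y, hy⟩ : ∃ y, y = β ^ 2 := ⟨_, rfl⟩
  obtain ⟨z, hz⟩ : ∃ z, z = (β ^ 3)⁻¹ := ⟨_, rfl⟩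
  have hxyz : x * y * z = 1 := by rw [hx, hy, hz]; field_simp
  have hxn : x ^ (2 ^ m + 1) = 1 := hx ▸ hβ1
  have hyn : y ^ (2 ^ m + 1) = 1 := by rw [hy, pow_right_comm, hβ1, one_pow]
  have hzn : z ^ (2 ^ m + 1) = 1 := by rw [hz, inv_pow, pow_right_comm, hβ1, one_pow, inv_one]
  have hx3 : x ^ 3 + 1 ≠ 0 := by
    rw [ne_eq, CharTwo.add_eq_zero, hx]; exact hβn 3 (by norm_num) (by norm_num)
  have hy3 : y ^ 3 + 1 ≠ 0 := by
    rw [ne_eq, CharTwo.add_eq_zero, hy, ← pow_mul]; exact hβn 6 (by norm_num) (by norm_num)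
  have hz3 : z ^ 3 + 1 ≠ 0 := by
    rw [ne_eq, CharTwo.add_eq_zero, hz, inv_pow, inv_eq_one, ← pow_mul]
    exact hβn 9 (by norm_num) (by norm_num)
  have hyz : y + z ≠ 0 := by
    rw [ne_eq, CharTwo.add_eq_zero, hy, hz]
    intro h
    apply hβn 5 (by norm_num) (by norm_num)
    rw [pow_add β 2 3, h, inv_mul_cancel₀ (pow_ne_zero _ hβ0)]
  have weight : ∀ r s t : L, r * s * t = 1 → r ^ (2 ^ m + 1) = 1 → s ^ (2 ^ m + 1) = 1 →
      t ^ (2 ^ m + 1) = 1 → r ^ 3 + 1 ≠ 0 → ∃ d : L, d ^ 2 ^ m = d ∧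
        d * (r ^ 3 + 1) = r ^ 2 * (s + t) ∧ r ^ 2 ^ m = s * t := by
    intro r s t hrst hr hs ht hr3
    have hr0 : r ≠ 0 := by rintro rfl; simp at hr
    have hs0 : s ≠ 0 := by rintro rfl; simp at hs
    have ht0 : t ≠ 0 := by rintro rfl; simp at ht
    have hrc : r ^ 2 ^ m = s * t :=
      mul_right_cancel₀ hr0 ((hconj r hr).trans (by rw [← hrst]; ring))
    have hsc : s ^ 2 ^ m = r * t :=
      mul_right_cancel₀ hs0 ((hconj s hs).trans (by rw [← hrst]; ring))
    have htc : t ^ 2 ^ m = r * s :=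
      mul_right_cancel₀ ht0 ((hconj t ht).trans (by rw [← hrst]))
    refine ⟨r ^ 2 * (s + t) / (r ^ 3 + 1), ?_, div_mul_cancel₀ _ hr3, hrc⟩
    have hr3' : (s * t) ^ 3 + 1 ≠ 0 := by
      intro h
      apply hr3
      linear_combination r ^ 3 * h - ((r * s * t) ^ 2 + r * s * t + 1) * hrst
    rw [div_pow, mul_pow, add_pow_char_pow, add_pow_char_pow, pow_right_comm r 2,
      pow_right_comm r 3, hrc, hsc, htc, one_pow, div_eq_div_iff hr3' hr3]
    have hst : s * t = r⁻¹ := eq_inv_of_mul_eq_one_right (by rw [← hrst]; ring)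
    rw [show (s * t) ^ 2 * (r * t + r * s) = (s * t) ^ 2 * r * (s + t) by ring, hst]
    field_simp
    ring
  obtain ⟨d, hdq, hd, hxc⟩ := weight x y z hxyz hxn hyn hzn hx3
  obtain ⟨e, heq, he, hyc⟩ := weight y x z (by rw [← hxyz]; ring) hyn hxn hzn hy3
  obtain ⟨f, hfq, hf, hzc⟩ := weight z x y (by rw [← hxyz]; ring) hzn hxn hyn hz3
  have hx0 : x ≠ 0 := hx ▸ hβ0
  have hy0 : y ≠ 0 := by rintro rfl; simp at hyn
  have hz0 : z ≠ 0 := by rintro rfl; simp at hzn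
  have hd' : d * (x ^ 2 + y * z) = x * (y + z) :=
    mul_left_cancel₀ hx0 (by linear_combination hd + d * hxyz)
  have he' : e * (y ^ 2 + x * z) = y * (x + z) :=
    mul_left_cancel₀ hy0 (by linear_combination he + e * hxyz)
  have hf' : f * (z ^ 2 + x * y) = z * (x + y) :=
    mul_left_cancel₀ hz0 (by linear_combination hf + f * hxyz)
  obtain ⟨F₁, hF₁⟩ : ∃ F, F = d * x + e * y + f * z := ⟨_, rfl⟩
  obtain ⟨F₂, hF₂⟩ : ∃ F, F = d * x ^ 2 + e * y ^ 2 + f * z ^ 2 := ⟨_, rfl⟩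
  obtain ⟨F₃, hF₃⟩ : ∃ F, F = d * x ^ 3 + e * y ^ 3 + f * z ^ 3 := ⟨_, rfl⟩
  have hF₁q : F₁ ^ 2 ^ m = F₂ := by
    rw [hF₁, hF₂, add_pow_char_pow, add_pow_char_pow, mul_pow, mul_pow, mul_pow, hdq, heq, hfq,
      hxc, hyc, hzc]
    linear_combination hd' + he' + hf' +
      (x * y + x * z + y * z - d * x ^ 2 - e * y ^ 2 - f * z ^ 2) * h2
  have hF₂q : F₂ ^ 2 ^ m = F₁ := by rw [← hF₁q, hinvol]
  have hF₃q : F₃ ^ 2 ^ m = F₃ := by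
    rw [hF₃, add_pow_char_pow, add_pow_char_pow, mul_pow, mul_pow, mul_pow, hdq, heq, hfq,
      pow_right_comm x, pow_right_comm y, pow_right_comm z, hxc, hyc, hzc]
    have cube : ∀ r s t g : L, r * s * t = 1 → r ≠ 0 → g * (r ^ 3 + 1) = r ^ 2 * (s + t) →
        g * ((s * t) ^ 3 + r ^ 3) = (r ^ 2 + s * t) * (s + t) := fun r s t g hrst hr hg =>
      mul_left_cancel₀ (pow_ne_zero 3 hr) (by
        linear_combination (g * ((r * s * t) ^ 2 + r * s * t + 1) - r ^ 2 * (s + t)) * hrst -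
          g * r ^ 3 * h2 + (r ^ 3 + 1) * hg)
    linear_combination cube x y z d hxyz hx0 hd + cube y x z e (by rw [← hxyz]; ring) hy0 he +
      cube z x y f (by rw [← hxyz]; ring) hz0 hf +
      (x ^ 2 * (y + z) + y ^ 2 * (x + z) + z ^ 2 * (x + y) -
        d * x ^ 3 - e * y ^ 3 - f * z ^ 3) * h2
  refine exists_bch_word (ι := Fin 6) hK hβ (u := ![x, y, z, 1, w, w ^ 2])
    (a := ![d, e, f, F₃ + F₁ + F₂, F₃ + F₁ * w ^ 2 + F₂ * w, F₃ + F₁ * w + F₂ * w ^ 2])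
    (k₀ := 0) ?_ ?_ ?_ ?_ ?_
  · simp [Fin.forall_fin_succ, hxn, hyn, hzn, hwn, pow_right_comm w 2]
  · simp [Fin.forall_fin_succ, hdq, heq, hfq, add_pow_char_pow, mul_pow, hF₁q, hF₂q, hF₃q, hwq,
      hw2q, add_right_comm]
  · have hcube : ∀ v : L, v ^ 3 = 1 → v ≠ x := fun v hv h =>
      hβn 3 (by norm_num) (by norm_num) (by rw [← hx, ← h, hv])
    have hyx : y ≠ x := by
      rw [hx, hy]
      intro h
      exact hβn 1 (by norm_num) (by norm_num)
        (mul_left_cancel₀ hβ0 (by rw [mul_one, pow_one, ← pow_two, h]))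
    have hzx : z ≠ x := by
      rw [hx, hz]
      intro h
      apply hβn 4 (by norm_num) (by norm_num)
      rw [pow_succ' β 3]
      nth_rewrite 1 [← h]
      exact inv_mul_cancel₀ (pow_ne_zero _ hβ0)
    have h1x := hcube 1 (one_pow 3)
    have hwx := hcube w hw3
    have hw2x := hcube (w ^ 2) (by rw [pow_right_comm, hw3, one_pow])
    simp [Fin.forall_fin_succ, hyx, hzx, h1x, hwx, hw2x]
  · rintro h
    simp only [Matrix.cons_val_zero] at h
    simp [h, hx0, hyz] at hd
  · rintro j (rfl | rfl | rfl)
    · simp only [Fin.sum_univ_six, Matrix.cons_val]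
      linear_combination -hF₁ + (F₃ + F₂ * (w ^ 2 - w + 1)) * hw + F₁ * (1 + w ^ 3) * h2
    · simp only [Fin.sum_univ_six, Matrix.cons_val]
      linear_combination -hF₂ + (F₃ * (w ^ 2 - w + 1) + F₁ * (w ^ 3 - w + 1) +
        F₂ * (w - 1) * (w ^ 3 + 2)) * hw + 2 * F₂ * h2
    · simp only [Fin.sum_univ_six, Matrix.cons_val]
      linear_combination -hF₃ + (F₃ * (w - 1) * (w ^ 3 + 2) +
        F₁ * ((w - 1) * (w ^ 2 + w * (w ^ 3 + 1)) + 1) +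
        F₂ * ((w - 1) * (w + w ^ 2 * (w ^ 3 + 1)) + 1)) * hw + 2 * F₃ * h2

lemma sum_pow_eq_zero_of_ne_one {L : Type*} [Field L] {n : ℕ} {x : L} (hx : x ^ n = 1)
    (hx1 : x ≠ 1) : ∑ i : Fin n, x ^ (i : ℕ) = 0 := by
  rw [Fin.sum_univ_eq_sum_range (x ^ ·)]
  exact mul_left_cancel₀ (sub_ne_zero.2 hx1) (by rw [mul_geom_sum, hx, sub_self, mul_zero])

/-- The first three power moments of a word can be prescribed arbitrarily. -/
lemma exists_word_with_moments {K L : Type*} [Field K] [Fintype K]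
    [Field L] [Fintype L] [Algebra K L] [CharP L 2] {m : ℕ} (hm : 3 ≤ m)
    (hK : Fintype.card K = 2 ^ m) (hL : Fintype.card L = 2 ^ (2 * m))
    {β : L} (hβ : orderOf β = 2 ^ m + 1) (y : Fin 3 → L) :
    ∃ c : Fin (2 ^ m + 1) → K, ∀ k : Fin 3,
      ∑ i, algebraMap K L (c i) * β ^ ((i : ℕ) * (k + 1)) = y k := by
  have hβ1 : β ^ (2 ^ m + 1) = 1 := hβ ▸ pow_orderOf_eq_one β
  have hβ0 : β ≠ 0 := by rintro rfl; simp at hβ1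
  have hβq : β ^ 2 ^ m = β⁻¹ := eq_inv_of_mul_eq_one_left (by rw [← pow_succ, hβ1])
  have hq : 2 ^ 3 ≤ 2 ^ m := Nat.pow_le_pow_right two_pos hm
  have hinvol : ∀ x : L, (x ^ 2 ^ m) ^ 2 ^ m = x := fun x => by
    rw [← pow_mul, ← pow_add, ← two_mul, ← hL, FiniteField.pow_card]
  have hex : ∀ i : Fin (2 ^ m + 1), ∃ b : K, algebraMap K L b =
      ∑ j : Fin 3, (y j * (β⁻¹ ^ ((j : ℕ) + 1)) ^ (i : ℕ) +
        y j ^ 2 ^ m * (β ^ ((j : ℕ) + 1)) ^ (i : ℕ)) := fun i => by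
    apply mem_range_algebraMap_of_pow_card_eq
    rw [hK, sum_pow_char_pow]
    refine Finset.sum_congr rfl fun j _ => ?_
    have hpow : ∀ a b : ℕ, ((β ^ a) ^ b) ^ 2 ^ m = (β⁻¹ ^ a) ^ b := fun a b => by
      rw [← hβq]; ring
    have hpow' : ∀ a b : ℕ, ((β⁻¹ ^ a) ^ b) ^ 2 ^ m = (β ^ a) ^ b := fun a b => by
      rw [← hpow, hinvol]
    rw [add_pow_char_pow, mul_pow, mul_pow, hinvol, hpow, hpow', add_comm]
  choose c hc using hex
  refine ⟨c, fun k => ?_⟩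
  have hsame : ∀ j : Fin 3, ∑ i : Fin (2 ^ m + 1),
      (β⁻¹ ^ ((j : ℕ) + 1) * β ^ ((k : ℕ) + 1)) ^ (i : ℕ) = if j = k then 1 else 0 := by
    intro j
    split_ifs with hjk
    · subst hjk
      have h2 : (2 : L) = 0 := CharTwo.two_eq_zero
      simp only [← mul_pow, inv_mul_cancel₀ hβ0, one_pow]
      have hm0 : m ≠ 0 := by omega
      simp [h2, hm0]
    · refine sum_pow_eq_zero_of_ne_one ?_ fun h => hjk ?_
      · rw [mul_pow, pow_right_comm, pow_right_comm β, inv_pow, hβ1, inv_one, one_pow, one_pow,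
          one_mul]
      · rw [inv_pow, inv_mul_eq_one₀ (pow_ne_zero _ hβ0)] at h
        have := pow_injOn_Iio_orderOf (by simp only [hβ, Set.mem_Iio]; omega)
          (by simp only [hβ, Set.mem_Iio]; omega) h
        omega
  have hopp : ∀ j : Fin 3, ∑ i : Fin (2 ^ m + 1),
      (β ^ ((j : ℕ) + 1) * β ^ ((k : ℕ) + 1)) ^ (i : ℕ) = 0 := by
    intro j
    rw [← pow_add]
    refine sum_pow_eq_zero_of_ne_one (by rw [pow_right_comm, hβ1, one_pow]) ?_
    exact pow_ne_one_of_lt_orderOf (by omega) (by omega)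
  calc _ = ∑ j : Fin 3, (y j * ∑ i : Fin (2 ^ m + 1),
        (β⁻¹ ^ ((j : ℕ) + 1) * β ^ ((k : ℕ) + 1)) ^ (i : ℕ) +
          y j ^ 2 ^ m * ∑ i : Fin (2 ^ m + 1),
            (β ^ ((j : ℕ) + 1) * β ^ ((k : ℕ) + 1)) ^ (i : ℕ)) := by
        simp only [hc, Finset.sum_mul, Finset.mul_sum, ← Finset.sum_add_distrib]
        rw [Finset.sum_comm]
        refine Finset.sum_congr rfl fun j _ => Finset.sum_congr rfl fun i _ => ?_
        rw [mul_comm (i : ℕ), pow_mul β]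
        ring
    _ = y k := by
        simp only [hsame, hopp, mul_zero, add_zero, mul_ite, mul_one, Finset.sum_ite_eq',
          Finset.mem_univ, if_true]

lemma finrank_bch {K L : Type*} [Field K] [Fintype K]
    [Field L] [Fintype L] [Algebra K L] [CharP L 2] {m : ℕ} (hm : 3 ≤ m)
    (hK : Fintype.card K = 2 ^ m) (hL : Fintype.card L = 2 ^ (2 * m))
    {β : L} (hβ : orderOf β = 2 ^ m + 1) {C : Submodule K (Fin (2 ^ m + 1) → K)}
    (hC : ∀ c : Fin (2 ^ m + 1) → K,
      c ∈ C ↔ ∀ j ∈ ({1, 2, 3} : Set ℕ),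
        ∑ i : Fin (2 ^ m + 1), algebraMap K L (c i) * β ^ ((i : ℕ) * j) = 0) :
    Module.finrank K C = 2 ^ m - 5 := by
  obtain ⟨Φ, hΦ⟩ : ∃ Φ : (Fin (2 ^ m + 1) → K) →ₗ[K] (Fin 3 → L),
      Φ = Fintype.linearCombination K 
        fun (i : Fin (2 ^ m + 1)) (k : Fin 3) => β ^ ((i : ℕ) * ((k : ℕ) + 1)) := ⟨_, rfl⟩
  have hΦ' : ∀ c k, Φ c k = ∑ i, algebraMap K L (c i) * β ^ ((i : ℕ) * ((k : ℕ) + 1)) := by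
    intro c k
    simp [hΦ, Fintype.linearCombination_apply, Algebra.smul_def]
  have hker : C = LinearMap.ker Φ := by
    ext c
    rw [hC, LinearMap.mem_ker, funext_iff]
    simp [hΦ', Fin.forall_fin_succ]
  have hsurj : Function.Surjective Φ := fun y => by
    obtain ⟨c, hc⟩ := exists_word_with_moments hm hK hL hβ y
    exact ⟨c, funext fun k => by rw [hΦ', hc]⟩
  have hfin : Module.finrank K L = 2 := by
    have := Module.card_eq_pow_finrank (K := K) (V := L)
    rw [hK, hL, ← pow_mul, mul_comm 2] at this
    exact (Nat.eq_of_mul_eq_mul_left (by omega) (Nat.pow_right_injective le_rfl this)).symm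
  have hrank := LinearMap.finrank_range_add_finrank_ker Φ
  rw [LinearMap.range_eq_top.2 hsurj, finrank_top, ← hker, Module.finrank_pi_fintype] at hrank
  simp [hfin] at hrank
  omega

/-- Let `q = 2^m`, `m ≥ 4`, `K = GF(q)`, `L = GF(q^2)`, and let `β ∈ L` be a primitive
`(q+1)`-st root of unity. The narrow-sense BCH code of length `q+1` over `K` with
designed distance 4 (the cyclic code whose codewords are the vectors
`c : Fin (q+1) → K` with `∑ i c_i β^{ij} = 0` for `j = 1, 2, 3`, i.e. whose generator
polynomial is `lcm(M_β, M_{β^2}, M_{β^3})`) has dimension `q - 5` and minimum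
distance `6` if `m` is odd, `5` if `m` is even. -/
theorem stmt_18 (m : ℕ) (hm : 4 ≤ m)
    (K L : Type*) [Field K] [Field L] [Algebra K L]
    [Fintype K] [Fintype L] [DecidableEq K]
    (hK : Fintype.card K = 2 ^ m) (hL : Fintype.card L = 2 ^ (2 * m))
    (β : L) (hβ : orderOf β = 2 ^ m + 1)
    (C : Submodule K (Fin (2 ^ m + 1) → K))
    (hC : ∀ c : Fin (2 ^ m + 1) → K,
      c ∈ C ↔ ∀ j ∈ ({1, 2, 3} : Set ℕ),
        ∑ i : Fin (2 ^ m + 1), algebraMap K L (c i) * β ^ ((i : ℕ) * j) = 0) :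
    Module.finrank K C = 2 ^ m - 5 ∧
    (∀ c ∈ C, c ≠ 0 →
      (if Odd m then 6 else 5) ≤ (Finset.univ.filter fun i => c i ≠ 0).card) ∧
    (∃ c ∈ C, c ≠ 0 ∧
      (Finset.univ.filter fun i => c i ≠ 0).card = if Odd m then 6 else 5) := by
  have h2 : (2 : L) = 0 := by
    have h := FiniteField.cast_card_eq_zero L
    rw [hL, Nat.cast_pow, Nat.cast_ofNat] at h
    exact pow_eq_zero_iff (by omega) |>.1 h
  have : CharP L 2 := CharTwo.of_one_ne_zero_of_two_eq_zero one_ne_zero h2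
  refine ⟨finrank_bch (by omega) hK hL hβ hC, ?_⟩
  by_cases hodd : Odd m
  · have hlow := fun c (hc : c ∈ C) (hc0 : c ≠ 0) =>
      six_le_card_support (by omega) hodd hK hβ ((hC c).1 hc) hc0
    obtain ⟨c, hc, hc0, hcard⟩ := exists_bch_word_card_support_le_six hm hodd hK hL hβ
    simp only [if_pos hodd]
    exact ⟨hlow, c, (hC c).2 hc, hc0, hcard.antisymm (hlow c ((hC c).2 hc) hc0)⟩
  · have hlow := fun c (hc : c ∈ C) (hc0 : c ≠ 0) =>
      five_le_card_support (by omega) hK hβ ((hC c).1 hc) hc0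
    obtain ⟨c, hc, hc0, hcard⟩ :=
      exists_bch_word_card_support_le_five (by omega) (Nat.not_odd_iff_even.1 hodd) hK hβ
    simp only [if_neg hodd]
    exact ⟨hlow, c, (hC c).2 hc, hc0, hcard.antisymm (hlow c ((hC c).2 hc) hc0)⟩
end

section
/- Let q = 2^m with m ≥ 5 odd and let U be the group of (q+1)-st roots of unity in GF(q^2). The incidence structure with point set U and blocks all 6-subsets {u1,...,u6} of U satisfying σ_{6,3}(u1,...,u6) = 0 is a 4-(q+1, 6, (q−8)/2) design: every 4-subset of U is contained in exactly (q−8)/2 such blocks. -/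
/-- The third elementary symmetric polynomial of six elements, expanded in two of them. -/
theorem esymm_three_six {R : Type*} [CommRing R] (a b c d x y : R) :
    Multiset.esymm (x ::ₘ y ::ₘ {a, b, c, d}) 3 =
      (a * b * c + a * b * d + a * c * d + b * c * d) +
        (a * b + a * c + a * d + b * c + b * d + c * d) * (x + y) +
          (a + b + c + d) * (x * y) := by
  simp only [Multiset.esymm, Multiset.insert_eq_cons, ← Multiset.cons_zero,
    Multiset.powersetCard_cons, Multiset.powersetCard_zero_right, Multiset.powersetCard_zero_left,
    Multiset.map_add, Multiset.map_cons, Multiset.map_zero, Multiset.prod_cons,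
    Multiset.prod_zero, Multiset.sum_add, Multiset.sum_cons, Multiset.sum_zero]
  simp
  ring

/-- An involution of a finite set with a single fixed point, mapping `T` off itself: the number
of sets obtained by adding to `T` an orbit of length two disjoint from `T`. -/
theorem card_extend_by_orbits {α : Type*} [DecidableEq α] (V T : Finset α) (f : α → α) (x₀ : α)
    (hTV : T ⊆ V) (hfV : ∀ x ∈ V, f x ∈ V) (hff : ∀ x ∈ V, f (f x) = x)
    (hfT : ∀ x ∈ T, f x ∉ T) (hx₀ : x₀ ∈ V) (hfix : ∀ x ∈ V, f x = x ↔ x = x₀) :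
    2 * ((V.filter fun x => x ∉ T ∧ f x ∉ T ∧ f x ≠ x).image
      fun x => insert x (insert (f x) T)).card + (2 * T.card + 1) = V.card := by
  set W := V.filter fun x => x ∉ T ∧ f x ∉ T ∧ f x ≠ x with hW
  have h1 : W.card = 2 * (W.image fun x => insert x (insert (f x) T)).card := by
    rw [Finset.card_eq_sum_card_image (fun x => insert x (insert (f x) T)) W, mul_comm,
      ← smul_eq_mul, ← Finset.sum_const]
    refine Finset.sum_congr rfl fun s hs => ?_
    obtain ⟨x, hx, rfl⟩ := Finset.mem_image.1 hs
    rw [hW, Finset.mem_filter] at hx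
    obtain ⟨hxV, hxT, hfxT, hne⟩ := hx
    rw [show (W.filter fun y => insert y (insert (f y) T) = insert x (insert (f x) T)) = {x, f x}
      from ?_, Finset.card_pair (Ne.symm hne)]
    ext y
    simp only [Finset.mem_filter, Finset.mem_insert, Finset.mem_singleton, hW]
    constructor
    · rintro ⟨⟨-, hyT, -⟩, h⟩
      have : y ∈ insert x (insert (f x) T) := h ▸ Finset.mem_insert_self _ _
      simpa [hyT] using this
    · rintro (rfl | rfl)
      · exact ⟨⟨hxV, hxT, hfxT, hne⟩, rfl⟩
      · rw [hff x hxV]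
        exact ⟨⟨hfV x hxV, hfxT, hxT, Ne.symm hne⟩, Finset.insert_comm _ _ _⟩
  have hinj : Set.InjOn f T := fun x hx y hy h => by
    rw [← hff x (hTV hx), ← hff y (hTV hy), h]
  have hx₀f : f x₀ = x₀ := (hfix x₀ hx₀).2 rfl
  have hx₀T : x₀ ∉ T := fun h => hfT x₀ h (by rwa [hx₀f])
  have h2 : V \ W = insert x₀ (T ∪ T.image f) := by
    ext y
    simp only [hW, Finset.mem_sdiff, Finset.mem_filter, Finset.mem_insert, Finset.mem_union,
      Finset.mem_image]
    constructor
    · rintro ⟨hy, h⟩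
      by_cases hyT : y ∈ T
      · exact Or.inr (Or.inl hyT)
      by_cases hfy : f y ∈ T
      · exact Or.inr (Or.inr ⟨f y, hfy, hff y hy⟩)
      · left
        rw [← hfix y hy]
        by_contra hne
        exact h ⟨hy, hyT, hfy, hne⟩
    · rintro (rfl | hy | ⟨z, hz, rfl⟩)
      · exact ⟨hx₀, fun h => h.2.2.2 hx₀f⟩
      · exact ⟨hTV hy, fun h => h.2.1 hy⟩
      · exact ⟨hfV z (hTV hz), fun h => h.2.2.1 (by rwa [hff z (hTV hz)])⟩
  have h3 : (V \ W).card = 2 * T.card + 1 := by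
    rw [h2, Finset.card_insert_of_notMem, Finset.card_union_of_disjoint,
      Finset.card_image_of_injOn hinj, two_mul]
    · rw [Finset.disjoint_right]
      intro y hy
      obtain ⟨z, hz, rfl⟩ := Finset.mem_image.1 hy
      exact hfT z hz
    · simp only [Finset.mem_union, Finset.mem_image, not_or, not_exists, not_and]
      refine ⟨hx₀T, fun z hz h => hx₀T ?_⟩
      rw [← hx₀f, ← h, hff z (hTV hz)]
      exact hz
  rw [← h1, ← h3, add_comm]
  exact Finset.card_sdiff_add_card_eq_card (Finset.filter_subset _ _)

section

variable {F : Type*} [Field F] (φ : F →+* F) {a b c d : F}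

/-- In characteristic two, let `φ` fix no primitive cube root of unity. For four elements inverted by
`φ`, the determinant of the involution `x ↦ (e₃ + e₂ x) / (e₂ + e₁ x)` is nonzero: otherwise a
cross-ratio of the four elements, which `φ` fixes, would be a primitive cube root of unity. -/
theorem resolvent_ne_zero [CharP F 2] (hφ : ∀ t, φ t = t → t ^ 2 + t + 1 ≠ 0)
    (ha : φ a * a = 1) (hb : φ b * b = 1) (hc : φ c * c = 1) (hd : φ d * d = 1)
    (hac : a ≠ c) (hbd : b ≠ d) :
    (a * b + a * c + a * d + b * c + b * d + c * d) ^ 2 +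
      (a + b + c + d) * (a * b * c + a * b * d + a * c * d + b * c * d) ≠ 0 := by
  have h2 : (2 : F) = 0 := CharTwo.two_eq_zero
  have key : ∀ x y : F, x + y = 0 → x = y := fun x y h => CharTwo.add_eq_zero.1 h
  have hr : (a + c) * (b + d) ≠ 0 :=
    mul_ne_zero (fun h => hac (key _ _ h)) fun h => hbd (key _ _ h)
  intro h
  have ha0 : a ≠ 0 := right_ne_zero_of_mul_eq_one ha
  have hb0 : b ≠ 0 := right_ne_zero_of_mul_eq_one hb
  have hc0 : c ≠ 0 := right_ne_zero_of_mul_eq_one hc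
  have hd0 : d ≠ 0 := right_ne_zero_of_mul_eq_one hd
  refine hφ ((a + d) * (b + c) / ((a + c) * (b + d))) ?_ ?_
  · have hne : φ ((a + c) * (b + d)) ≠ 0 := (map_ne_zero φ).2 hr
    rw [map_div₀, div_eq_div_iff hne hr]
    simp only [map_mul, map_add, eq_inv_of_mul_eq_one_left ha, eq_inv_of_mul_eq_one_left hb,
      eq_inv_of_mul_eq_one_left hc, eq_inv_of_mul_eq_one_left hd]
    field_simp
    ring
  · have : ((a + d) * (b + c)) ^ 2 + (a + d) * (b + c) * ((a + c) * (b + d)) +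
        ((a + c) * (b + d)) ^ 2 = 0 := by
      rw [← h]
      grind
    generalize (a + d) * (b + c) = x, (a + c) * (b + d) = y at this hr
    field_simp
    linear_combination this

/-- A Möbius map with self-conjugate coefficients preserves the set of elements inverted by `φ`. -/
theorem conj_moebius {e₁ e₂ e₃ e₄ x y : F} (h₁ : φ e₁ * e₄ = e₃) (h₂ : φ e₂ * e₄ = e₂)
    (h₃ : φ e₃ * e₄ = e₁) (hx : φ x * x = 1) (hden : e₂ + e₁ * x ≠ 0)
    (h : y * (e₂ + e₁ * x) = e₃ + e₂ * x) : φ y * y = 1 := by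
  have h' : φ y * (e₂ * x + e₃) = e₁ * x + e₂ := by
    have := congrArg φ h
    simp only [map_mul, map_add] at this
    linear_combination this * e₄ * x - φ y * x * h₂ - φ y * h₁ + h₃ * x + h₂ - (φ y * φ e₁ * e₄ - φ e₂ * e₄) * hx
  refine mul_right_cancel₀ hden ?_
  linear_combination φ y * h + h'

/-- The pole of the Möbius map `x ↦ (e₃ + e₂ x) / (e₂ + e₁ x)` is not inverted by `φ`. -/
theorem moebius_den_ne_zero [CharP F 2] {e₁ e₂ e₃ e₄ x : F} (h₁ : φ e₁ * e₄ = e₃) (h₂ : φ e₂ * e₄ = e₂)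
    (hx : φ x * x = 1) (hdet : e₂ ^ 2 + e₁ * e₃ ≠ 0) : e₂ + e₁ * x ≠ 0 := by
  intro h
  have h' := congrArg φ h
  simp only [map_mul, map_add, map_zero] at h'
  have h2 : (2 : F) = 0 := CharTwo.two_eq_zero
  have : e₂ * x + e₃ = 0 := by
    linear_combination h' * e₄ * x - x * h₂ - h₁ - φ e₁ * e₄ * hx
  apply hdet
  grind

end

/-- A field with `q ^ 2` elements, `q = 2 ^ m`, has `q + 1` roots of unity of order dividing `q + 1`. -/
theorem card_unit_circle (m : ℕ) (F : Type*) [Field F] [Fintype F] [DecidableEq F]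
    (hF : Fintype.card F = 2 ^ (2 * m)) :
    (Finset.univ.filter fun x : F => x ^ (2 ^ m + 1) = 1).card = 2 ^ m + 1 := by
  have hq : 1 ≤ 2 ^ m := Nat.one_le_two_pow
  have hcard : Nat.card Fˣ = (2 ^ m + 1) * (2 ^ m - 1) := by
    rw [Nat.card_eq_fintype_card, Fintype.card_units, hF, mul_comm 2 m, pow_mul,
      ← Nat.sq_sub_sq, one_pow]
  have hker := IsCyclic.card_powMonoidHom_ker (G := Fˣ) (2 ^ m + 1)
  rw [hcard, Nat.gcd_eq_right (dvd_mul_right _ _)] at hker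
  refine Eq.trans ?_ hker
  rw [Nat.card_eq_fintype_card, ← Finset.card_univ]
  symm
  refine Finset.card_bij (fun u _ => ((u : Fˣ) : F)) (fun u _ => ?_) (fun u _ v _ h => ?_)
    fun x hx => ?_
  · have h : (u : Fˣ) ^ (2 ^ m + 1) = 1 := u.2
    simp [← Units.val_pow_eq_pow_val, h]
  · exact Subtype.ext (Units.ext h)
  · have hx' : x ^ (2 ^ m + 1) = 1 := by simpa using hx
    exact ⟨⟨Units.ofPowEqOne x _ hx' (Nat.succ_ne_zero _), Units.pow_ofPowEqOne hx' _⟩,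
      Finset.mem_univ _, rfl⟩

/-- For odd `m`, the field with `2 ^ m` elements contains no primitive cube root of unity. -/
theorem no_cube_root (m : ℕ) (hmo : Odd m) {F : Type*} [Field F] [CharP F 2] (t : F)
    (ht : t ^ 2 ^ m = t) : t ^ 2 + t + 1 ≠ 0 := by
  intro h
  have h2 : (2 : F) = 0 := CharTwo.two_eq_zero
  have h3 : t ^ 3 = 1 := by linear_combination (t - 1) * h
  have hmod : 2 ^ m % 3 = 2 := by
    obtain ⟨k, rfl⟩ := hmo
    rw [pow_succ, pow_mul, Nat.mul_mod, Nat.pow_mod]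
    norm_num
  rw [← Nat.div_add_mod (2 ^ m) 3, hmod, pow_add, pow_mul, h3, one_pow, one_mul] at ht
  have h4 : (1 : F) = 0 := by
    linear_combination h - ht - t * h2
  exact one_ne_zero h4

/-- For `q = 2^m` with `m ≥ 5` odd, the incidence structure on the `(q+1)`-st roots of
unity `U ⊆ GF(q^2)` whose blocks are the 6-subsets with vanishing `σ_{6,3}` is a
`4-(q+1, 6, (q-8)/2)` design: every 4-subset of `U` lies in exactly `(q-8)/2` blocks. -/
theorem stmt_19 (m : ℕ) (hm : 5 ≤ m) (hmo : Odd m) (F : Type*) [Field F] [Fintype F]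
    (hF : Fintype.card F = 2 ^ (2 * m)) :
    ∀ T : Finset F, (∀ u ∈ T, u ^ (2 ^ m + 1) = 1) → T.card = 4 →
      Set.ncard {s : Finset F | (∀ u ∈ s, u ^ (2 ^ m + 1) = 1) ∧ s.card = 6 ∧
          Multiset.esymm s.val 3 = 0 ∧ T ⊆ s}
        = (2 ^ m - 8) / 2 := by
  classical
  intro T hTU hT
  have : Fact (Nat.Prime 2) := ⟨Nat.prime_two⟩
  have : CharP F 2 := charP_of_card_eq_prime_pow hF
  have h2 : (2 : F) = 0 := CharTwo.two_eq_zero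
  set φ := iterateFrobenius F 2 m
  have hφ : ∀ x : F, φ x = x ^ 2 ^ m := fun x => iterateFrobenius_def 2 m x
  have hφU : ∀ x : F, φ x * x = x ^ (2 ^ m + 1) := fun x => by rw [hφ, pow_succ]
  set V := Finset.univ.filter fun x : F => x ^ (2 ^ m + 1) = 1 with hV
  have hVφ : ∀ x, x ∈ V ↔ φ x * x = 1 := fun x => by simp [hV, hφU]
  have hTV : T ⊆ V := fun x hx => by simpa [hV] using hTU x hx
  obtain ⟨a, T', haT', rfl, hT'⟩ := Finset.card_eq_succ.1 hT
  obtain ⟨b, c, d, hbc, hbd, hcd, rfl⟩ := Finset.card_eq_three.1 hT'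
  simp only [Finset.mem_insert, Finset.mem_singleton, not_or] at haT'
  obtain ⟨hab, hac, had⟩ := haT'
  have ha := (hVφ a).1 (hTV (by simp))
  have hb := (hVφ b).1 (hTV (by simp))
  have hc := (hVφ c).1 (hTV (by simp))
  have hd := (hVφ d).1 (hTV (by simp))
  have ha0 : a ≠ 0 := right_ne_zero_of_mul_eq_one ha
  have hb0 : b ≠ 0 := right_ne_zero_of_mul_eq_one hb
  have hc0 : c ≠ 0 := right_ne_zero_of_mul_eq_one hc
  have hd0 : d ≠ 0 := right_ne_zero_of_mul_eq_one hd
  have hdet := resolvent_ne_zero φ (fun t ht => no_cube_root m hmo t (by rw [← hφ, ht]))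
    ha hb hc hd hac hbd
  obtain ⟨e₁, he₁⟩ : ∃ e, e = a + b + c + d := ⟨_, rfl⟩
  obtain ⟨e₂, he₂⟩ : ∃ e, e = a * b + a * c + a * d + b * c + b * d + c * d := ⟨_, rfl⟩
  obtain ⟨e₃, he₃⟩ : ∃ e, e = a * b * c + a * b * d + a * c * d + b * c * d := ⟨_, rfl⟩
  rw [← he₁, ← he₂, ← he₃] at hdet
  have hn : ∀ x y : F, x ≠ y → x + y ≠ 0 := fun x y h h' => h (CharTwo.add_eq_zero.1 h')
  have h₁ : φ e₁ * (a * b * c * d) = e₃ := by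
    simp only [he₁, he₃, map_add]
    linear_combination b * c * d * ha + a * c * d * hb + a * b * d * hc + a * b * c * hd
  have h₂ : φ e₂ * (a * b * c * d) = e₂ := by
    simp only [he₂, map_add, map_mul]
    rw [eq_inv_of_mul_eq_one_left ha, eq_inv_of_mul_eq_one_left hb,
      eq_inv_of_mul_eq_one_left hc, eq_inv_of_mul_eq_one_left hd]
    field_simp
    ring
  have h₃ : φ e₃ * (a * b * c * d) = e₁ := by
    simp only [he₁, he₃, map_add, map_mul]
    rw [eq_inv_of_mul_eq_one_left ha, eq_inv_of_mul_eq_one_left hb,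
      eq_inv_of_mul_eq_one_left hc, eq_inv_of_mul_eq_one_left hd]
    field_simp
    ring
  have h4 : a * b * c * d ≠ 0 := by simp [*]
  have he₁0 : e₁ ≠ 0 := by
    intro h
    have h3 : e₃ = 0 := by rw [← h₁, h, map_zero, zero_mul]
    apply mul_ne_zero (mul_ne_zero (hn a b hab) (hn a c hac)) (hn a d had)
    have h5 : (a + b) * (a + c) * (a + d) = a ^ 2 * e₁ + e₃ := by
      subst he₁ he₃
      ring
    rw [h5, h, h3]
    ring
  set f : F → F := fun x => (e₃ + e₂ * x) / (e₂ + e₁ * x) with hf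
  have hden : ∀ x ∈ V, e₂ + e₁ * x ≠ 0 := fun x hx =>
    moebius_den_ne_zero φ h₁ h₂ ((hVφ x).1 hx) hdet
  have hfeq : ∀ x ∈ V, ∀ y, y = f x ↔ e₃ + e₂ * (x + y) + e₁ * (x * y) = 0 := by
    intro x hx y
    rw [hf, eq_div_iff (hden x hx)]
    constructor
    · intro h
      linear_combination -h + h2 * y * (e₂ + e₁ * x)
    · intro h
      linear_combination -h + h2 * y * (e₂ + e₁ * x)
  have hfV : ∀ x ∈ V, f x ∈ V := fun x hx => (hVφ _).2 <|
    conj_moebius φ h₁ h₂ h₃ ((hVφ x).1 hx) (hden x hx) (div_mul_cancel₀ _ (hden x hx))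
  have hff : ∀ x ∈ V, f (f x) = x := by
    intro x hx
    refine ((hfeq (f x) (hfV x hx) x).2 ?_).symm
    rw [add_comm (f x), mul_comm (f x)]
    exact (hfeq x hx _).1 rfl
  have hfT : ∀ x ∈ ({a, b, c, d} : Finset F), f x ∉ ({a, b, c, d} : Finset F) := by
    intro x hx hfx
    have hxV := hTV hx
    have h := (hfeq x hxV _).1 rfl
    generalize f x = y at hfx h
    simp only [Finset.mem_insert, Finset.mem_singleton] at hx hfx
    have hab' := hn a b hab
    have hac' := hn a c hac
    have had' := hn a d had
    have hbc' := hn b c hbc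
    have hbd' := hn b d hbd
    have hcd' := hn c d hcd
    have hA := mul_ne_zero (mul_ne_zero hab' hac') had'
    have hB := mul_ne_zero (mul_ne_zero hab' hbc') hbd'
    have hC := mul_ne_zero (mul_ne_zero hac' hbc') hcd'
    have hD := mul_ne_zero (mul_ne_zero had' hbd') hcd'
    have hAB := mul_ne_zero (pow_ne_zero 2 hab') hcd'
    have hAC := mul_ne_zero (pow_ne_zero 2 hac') hbd'
    have hAD := mul_ne_zero (pow_ne_zero 2 had') hbc'
    have hBC := mul_ne_zero (pow_ne_zero 2 hbc') had'
    have hBD := mul_ne_zero (pow_ne_zero 2 hbd') hac'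
    have hCD := mul_ne_zero (pow_ne_zero 2 hcd') hab'
    clear_value f φ
    clear hfV hff hfeq hden hdet h₁ h₂ h₃ h4 he₁0 ha hb hc hd ha0 hb0 hc0 hd0 hTU hT hT' hTV
    rw [he₁, he₂, he₃] at h
    rcases hx with rfl | rfl | rfl | rfl <;> rcases hfx with rfl | rfl | rfl | rfl <;> grind only
  obtain ⟨x₀, hx₀⟩ : ∃ x₀, x₀ ^ 2 = e₃ / e₁ := by
    obtain ⟨r, hr⟩ := FiniteField.isSquare_of_char_two
      (CharP.ringChar_of_prime_eq_zero Nat.prime_two h2) (e₃ / e₁)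
    exact ⟨r, by rw [hr, sq]⟩
  have hx₀V : x₀ ∈ V := by
    have h3 : e₃ ≠ 0 := fun h => he₁0 (by rw [← h₃, h, map_zero, zero_mul])
    have hφ₁ : φ e₁ ≠ 0 := (map_ne_zero φ).2 he₁0
    rw [hVφ, ← CharTwo.sq_inj, mul_pow, ← map_pow, hx₀, map_div₀, div_mul_div_comm, one_pow,
      div_eq_one_iff_eq (mul_ne_zero hφ₁ he₁0)]
    refine mul_right_cancel₀ h4 ?_
    linear_combination e₃ * h₃ - e₁ * h₁
  have hfix : ∀ x ∈ V, f x = x ↔ x = x₀ := by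
    intro x hx
    rw [eq_comm, hfeq x hx, ← CharTwo.sq_inj (x := x), hx₀, eq_div_iff he₁0]
    constructor <;> intro h <;> grind
  have hcount := card_extend_by_orbits V {a, b, c, d} f x₀ hTV hfV hff hfT hx₀V hfix
  rw [hT, hV, card_unit_circle m F hF, ← hV] at hcount
  have hset : {s : Finset F | (∀ u ∈ s, u ^ (2 ^ m + 1) = 1) ∧ s.card = 6 ∧
      Multiset.esymm s.val 3 = 0 ∧ {a, b, c, d} ⊆ s} =
      ((V.filter fun x => x ∉ ({a, b, c, d} : Finset F) ∧ f x ∉ ({a, b, c, d} : Finset F) ∧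
        f x ≠ x).image fun x => insert x (insert (f x) {a, b, c, d}) : Finset (Finset F)) := by
    have hesymm : ∀ x y, x ∉ insert y ({a, b, c, d} : Finset F) →
        y ∉ ({a, b, c, d} : Finset F) →
        (insert x (insert y ({a, b, c, d} : Finset F))).val.esymm 3 =
          e₃ + e₂ * (x + y) + e₁ * (x * y) := by
      intro x y hx hy
      rw [he₁, he₂, he₃, ← esymm_three_six, Finset.insert_val_of_notMem hx,
        Finset.insert_val_of_notMem hy, Finset.insert_val_of_notMem (by simp [*]),
        Finset.insert_val_of_notMem (by simp [*]), Finset.insert_val_of_notMem (by simp [*])]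
      rfl
    ext s
    simp only [Set.mem_ofPred_eq, Finset.coe_image, Set.mem_image, Finset.mem_coe,
      Finset.mem_filter]
    constructor
    · rintro ⟨hsU, hs6, hs, hTs⟩
      have hsd : (s \ {a, b, c, d}).card = 2 := by
        rw [Finset.card_sdiff_of_subset hTs, hs6, hT]
      obtain ⟨x, y, hxy, hsxy⟩ := Finset.card_eq_two.1 hsd
      have hx : x ∈ s \ {a, b, c, d} := by simp [hsxy]
      have hy : y ∈ s \ {a, b, c, d} := by simp [hsxy]
      rw [Finset.mem_sdiff] at hx hy
      have hs' : s = insert x (insert y {a, b, c, d}) := by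
        rw [← Finset.sdiff_union_of_subset hTs, hsxy, Finset.insert_union,
          Finset.singleton_union]
      have hxV : x ∈ V := by simpa [hV] using hsU x hx.1
      rw [hs', hesymm x y (by rw [Finset.mem_insert, not_or]; exact ⟨hxy, hx.2⟩) hy.2,
        ← hfeq x hxV] at hs
      subst hs
      exact ⟨x, ⟨hxV, hx.2, hy.2, hxy.symm⟩, hs'.symm⟩
    · rintro ⟨x, ⟨hxV, hxT, hfxT, hne⟩, rfl⟩
      have hxi : x ∉ insert (f x) ({a, b, c, d} : Finset F) := by
        rw [Finset.mem_insert, not_or]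
        exact ⟨hne.symm, hxT⟩
      refine ⟨fun u hu => ?_, ?_, ?_, ?_⟩
      · rw [← hφU, ← hVφ]
        rw [Finset.mem_insert, Finset.mem_insert] at hu
        rcases hu with rfl | rfl | hu
        exacts [hxV, hfV _ hxV, hTV hu]
      · rw [Finset.card_insert_of_notMem hxi, Finset.card_insert_of_notMem hfxT, hT]
      · rw [hesymm _ _ hxi hfxT]
        exact (hfeq x hxV _).1 rfl
      · exact (Finset.subset_insert _ _).trans (Finset.subset_insert _ _)
  rw [hset, Set.ncard_coe_finset]
  omega
end
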